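/- Assume r = 1 and a₁ > 0. Then the set of K-points X_d(a₁)(K) (where d = t) is the disjoint union of the following three pieces: (i) the image ℙ^{t−1}₂ of ℙ^{t−1}(K) under the embedding j₂; (ii) the set-difference ℙ¹₁ ∖ {P₀}, where ℙ¹₁ is the image of ℙ¹(K) under the embedding j₁ and P₀ = ([1 : 0 : … : 0], [1 : 0 : … : 0]); and (iii) for each t′ with 2 ≤ t′ ≤ t, the image of the set of K-points of the good open subset U_{t′}(a₁) under the embedding ι_{t′}; moreover all these pieces are pairwise disjoint. -/

import Mathlib

/-- The defining equations of the Hirzebruch–Kleinschmidt variety `X_{t+r-1}(a₁,…,a_r)`,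
on homogeneous coordinate vectors: coordinates on `ℙ^{rt}` are indexed by
`Option (Fin t × Fin r)` (`none` is `x₀`, `some (i,j)` is `x_{(i+1)(j+1)}`) and
coordinates on `ℙ^{t-1}` by `Fin t`. The equations read
`x_{mj} y_n^{a_j} = x_{nj} y_m^{a_j}` for all `j` and all `m ≠ n`. -/
def HKrel (K : Type*) [Field K] {r t : ℕ} (a : Fin r → ℕ)
    (x : Option (Fin t × Fin r) → K) (y : Fin t → K) : Prop :=
  ∀ (j : Fin r) (m n : Fin t), m ≠ n →
    x (some (m, j)) * y n ^ a j = x (some (n, j)) * y m ^ a j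

/-- Two coordinate vectors define the same point of projective space: they differ by a
nonzero scalar. -/
def ScaleEq (K : Type*) [Field K] {α : Type*} (x x' : α → K) : Prop :=
  ∃ c : K, c ≠ 0 ∧ x = c • x'

/-- The `x`-part of the embedding `ι_{t'} : X_{t'}(a₁) → X_t(a₁)` (case `r = 1`):
`[x₀ : x₁₁ : … : x_{t'1}] ↦ [x₀ : x₁₁ : … : x_{t'1} : 0 : … : 0]`. -/
def padX (K : Type*) [Field K] (t t₁ : ℕ) (x : Option (Fin t₁ × Fin 1) → K) :
    Option (Fin t × Fin 1) → K := fun o =>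
  match o with
  | none => x none
  | some (i, j) => if hi : (i : ℕ) < t₁ then x (some (⟨(i : ℕ), hi⟩, j)) else 0

/-- The `y`-part of the embedding `ι_{t'}`: `[y₁ : … : y_{t'}] ↦ [y₁ : … : y_{t'} : 0 : … : 0]`. -/
def padY (K : Type*) [Field K] (t t₁ : ℕ) (y : Fin t₁ → K) : Fin t → K := fun i =>
  if hi : (i : ℕ) < t₁ then y ⟨(i : ℕ), hi⟩ else 0

/-- The `x`-part of the embedding `j₁ : ℙ¹(K) → X_t(a₁)(K)`:
`[z₀ : z₁] ↦ [z₀ : z₁ : 0 : … : 0]`. -/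
def j1X (K : Type*) [Field K] (t : ℕ) (z : Fin 2 → K) : Option (Fin t × Fin 1) → K := fun o =>
  match o with
  | none => z 0
  | some (i, _) => if (i : ℕ) = 0 then z 1 else 0

/-- The point `[1 : 0 : … : 0]` of `ℙ^{t-1}`. -/
def e1Y (K : Type*) [Field K] (t : ℕ) : Fin t → K := fun i =>
  if (i : ℕ) = 0 then 1 else 0

/-- The point `[1 : 0 : … : 0]` of `ℙ^t`, i.e. the `x`-part of the embedding `j₂` and the
first coordinate of the point `P₀`. -/
def e1X (K : Type*) [Field K] (t : ℕ) : Option (Fin t × Fin 1) → K := fun o =>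
  match o with
  | none => 1
  | some _ => 0

/-- `n` is the largest index `i` such that the coordinate `x_{i1}` does not vanish. -/
def IsTopIndex {K : Type*} [Field K] {t : ℕ} (x : Option (Fin t × Fin 1) → K) (n : ℕ) : Prop :=
  ∃ h : n < t, x (some (⟨n, h⟩, 0)) ≠ 0 ∧ ∀ j : Fin t, n < j → x (some (j, 0)) = 0

section HirzebruchKleinschmidt

variable {K : Type*} [Field K] {t : ℕ}

theorem IsTopIndex.unique {x : Option (Fin t × Fin 1) → K} {m n : ℕ}
    (hm : IsTopIndex x m) (hn : IsTopIndex x n) : m = n := by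
  obtain ⟨hmt, hm, hm'⟩ := hm
  obtain ⟨hnt, hn, hn'⟩ := hn
  rcases lt_trichotomy m n with h | h | h
  · exact absurd (hm' ⟨n, hnt⟩ h) hn
  · exact h
  · exact absurd (hn' ⟨m, hmt⟩ h) hm

theorem exists_isTopIndex {x : Option (Fin t × Fin 1) → K} {i : Fin t}
    (hi : x (some (i, 0)) ≠ 0) : ∃ n, IsTopIndex x n := by
  classical
  obtain ⟨m, hm, hmax⟩ := (Finset.univ.filter fun i : Fin t => x (some (i, 0)) ≠ 0).exists_max_image
    id ⟨i, by simpa using hi⟩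
  refine ⟨m, m.2, by simpa using hm, fun j hj => ?_⟩
  by_contra h
  exact absurd (hmax j (by simpa using h)) (not_le.2 hj)

theorem HKrel.eq {a : ℕ} {x : Option (Fin t × Fin 1) → K} {y : Fin t → K}
    (h : HKrel K (fun _ : Fin 1 => a) x y) (m n : Fin t) :
    x (some (m, 0)) * y n ^ a = x (some (n, 0)) * y m ^ a := by
  by_cases hmn : m = n
  · rw [hmn]
  · exact h 0 m n hmn

theorem HKrel.smul {a : ℕ} {x : Option (Fin t × Fin 1) → K} {y : Fin t → K}
    (h : HKrel K (fun _ : Fin 1 => a) x y) (c d : K) :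
    HKrel K (fun _ : Fin 1 => a) (c • x) (d • y) := by
  intro j m n hmn
  have := h j m n hmn
  simp only [Pi.smul_apply, smul_eq_mul, mul_pow] at this ⊢
  linear_combination c * d ^ a * this

theorem ScaleEq.refl {α : Type*} (x : α → K) : ScaleEq K x x :=
  ⟨1, one_ne_zero, (one_smul K x).symm⟩

theorem HKrel.apply_eq_zero {a : ℕ} (ha : 0 < a) {x : Option (Fin t × Fin 1) → K} {y : Fin t → K}
    (h : HKrel K (fun _ : Fin 1 => a) x y) {n : ℕ} (hn : IsTopIndex x n) (j : Fin t) (hj : n < j) :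
    y j = 0 := by
  obtain ⟨hnt, hx, hx'⟩ := hn
  have := h.eq ⟨n, hnt⟩ j
  rw [hx' j hj, zero_mul] at this
  exact (pow_eq_zero_iff ha.ne').1 ((mul_eq_zero.1 this).resolve_left hx)

theorem setOf_scaleEq_e1X (a : ℕ) :
    {p : (Option (Fin t × Fin 1) → K) × (Fin t → K) |
      ∃ y : Fin t → K, y ≠ 0 ∧ ScaleEq K p.1 (e1X K t) ∧ ScaleEq K p.2 y} =
    {p | (p.1 ≠ 0 ∧ p.2 ≠ 0 ∧ HKrel K (fun _ : Fin 1 => a) p.1 p.2) ∧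
      ∀ i, p.1 (some (i, 0)) = 0} := by
  ext ⟨x, y⟩
  constructor
  · rintro ⟨y', hy', ⟨c, hc, rfl⟩, ⟨d, hd, rfl⟩⟩
    refine ⟨⟨fun h => hc ?_, smul_ne_zero hd hy', fun j m n _ => ?_⟩, fun i => ?_⟩
    · simpa [e1X] using congrFun h none
    · simp [e1X]
    · simp [e1X]
  · rintro ⟨⟨hx, hy, -⟩, h⟩
    refine ⟨y, hy, ⟨x none, fun h0 => hx ?_, ?_⟩, ScaleEq.refl y⟩
    · funext o
      rcases o with _ | ⟨i, j⟩
      · exact h0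
      · rw [Subsingleton.elim j 0]; exact h i
    · funext o
      rcases o with _ | ⟨i, j⟩
      · simp [e1X]
      · rw [Subsingleton.elim j 0]; simpa [e1X] using h i

theorem setOf_scaleEq_j1X_diff (ht : 0 < t) {a : ℕ} (ha : 0 < a) :
    {p : (Option (Fin t × Fin 1) → K) × (Fin t → K) |
      ∃ z : Fin 2 → K, z ≠ 0 ∧ ScaleEq K p.1 (j1X K t z) ∧ ScaleEq K p.2 (e1Y K t)} \
      {p | ScaleEq K p.1 (e1X K t) ∧ ScaleEq K p.2 (e1Y K t)} =
    {p | (p.1 ≠ 0 ∧ p.2 ≠ 0 ∧ HKrel K (fun _ : Fin 1 => a) p.1 p.2) ∧ IsTopIndex p.1 0} := by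
  ext ⟨x, y⟩
  constructor
  · rintro ⟨⟨z, hz, ⟨c, hc, rfl⟩, ⟨d, hd, rfl⟩⟩, hP⟩
    have hz1 : z 1 ≠ 0 := by
      intro h1
      have hz0 : z 0 ≠ 0 := by
        intro h0
        exact hz (funext fun i => by fin_cases i <;> simp [h0, h1])
      refine hP ⟨⟨c * z 0, mul_ne_zero hc hz0, ?_⟩, ⟨d, hd, rfl⟩⟩
      funext o
      rcases o with _ | ⟨i, j⟩ <;> simp [j1X, e1X, h1]
    refine ⟨⟨fun h => ?_, fun h => hd ?_, HKrel.smul ?_ c d⟩, ht, ?_, ?_⟩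
    · simpa [j1X, hc, hz1] using congrFun h (some (⟨0, ht⟩, 0))
    · simpa [e1Y] using congrFun h ⟨0, ht⟩
    · intro j m n _
      by_cases hm : (m : ℕ) = 0 <;> by_cases hn : (n : ℕ) = 0 <;> simp [j1X, e1Y, hm, hn, ha.ne']
    · simp [j1X, hc, hz1]
    · intro j hj
      simp [j1X, hj.ne']
  · rintro ⟨⟨-, hy, h⟩, htop⟩
    have hy' := h.apply_eq_zero ha htop
    obtain ⟨_, hx0, hx'⟩ := htop
    refine ⟨⟨![x none, x (some (⟨0, ht⟩, 0))], fun h0 => hx0 ?_, ⟨1, one_ne_zero, ?_⟩,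
      ⟨y ⟨0, ht⟩, fun h0 => hy ?_, ?_⟩⟩, ?_⟩
    · simpa using congrFun h0 1
    · funext o
      rcases o with _ | ⟨i, j⟩
      · simp [j1X]
      · obtain rfl := Subsingleton.elim j 0
        by_cases hi : (i : ℕ) = 0
        · obtain rfl : i = ⟨0, ht⟩ := Fin.ext hi
          simp [j1X]
        · simpa [j1X, hi] using hx' i (Nat.pos_of_ne_zero hi)
    · funext i
      by_cases hi : (i : ℕ) = 0
      · obtain rfl : i = ⟨0, ht⟩ := Fin.ext hi
        exact h0
      · exact hy' i (Nat.pos_of_ne_zero hi)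
    · funext i
      by_cases hi : (i : ℕ) = 0
      · obtain rfl : i = ⟨0, ht⟩ := Fin.ext hi
        simp [e1Y]
      · simpa [e1Y, hi] using hy' i (Nat.pos_of_ne_zero hi)
    · rintro ⟨⟨c, -, hc⟩, -⟩
      exact hx0 (by simpa [e1X] using congrFun hc (some (⟨0, ht⟩, 0)))

theorem setOf_scaleEq_pad {k : ℕ} (hk : k + 2 ≤ t) {a : ℕ} (ha : 0 < a) :
    {p : (Option (Fin t × Fin 1) → K) × (Fin t → K) |
      ∃ (x : Option (Fin (k + 2) × Fin 1) → K) (y : Fin (k + 2) → K),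
        x ≠ 0 ∧ y ≠ 0 ∧ HKrel K (fun _ : Fin 1 => a) x y ∧
        x (some (Fin.last (k + 1), 0)) ≠ 0 ∧
        ScaleEq K p.1 (padX K t (k + 2) x) ∧ ScaleEq K p.2 (padY K t (k + 2) y)} =
    {p | (p.1 ≠ 0 ∧ p.2 ≠ 0 ∧ HKrel K (fun _ : Fin 1 => a) p.1 p.2) ∧
      IsTopIndex p.1 (k + 1)} := by
  ext ⟨x, y⟩
  constructor
  · rintro ⟨x', y', -, hy', h, hlast, ⟨c, hc, rfl⟩, ⟨d, hd, rfl⟩⟩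
    have hlast' : padX K t (k + 2) x' (some (⟨k + 1, hk⟩, 0)) ≠ 0 := by
      simpa [padX, Fin.last] using hlast
    refine ⟨⟨smul_ne_zero hc fun h0 => hlast' (by rw [h0]; rfl), smul_ne_zero hd fun h0 => hy' ?_,
      HKrel.smul ?_ c d⟩, hk, ?_, ?_⟩
    · funext i
      simpa [padY] using congrFun h0 ⟨i, i.2.trans_le hk⟩
    · intro j m n _
      obtain rfl := Subsingleton.elim j 0
      by_cases hm : (m : ℕ) < k + 2 <;> by_cases hn : (n : ℕ) < k + 2 <;>
        simp [padX, padY, hm, hn, ha.ne']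
      exact h.eq _ _
    · exact mul_ne_zero hc hlast'
    · intro j hj
      simp [padX, show ¬ (j : ℕ) < k + 2 by omega]
  · rintro ⟨⟨-, hy, h⟩, htop⟩
    have hy' := h.apply_eq_zero ha htop
    obtain ⟨_, hx0, hx'⟩ := htop
    have hpadX : x = padX K t (k + 2)
        fun o => x (o.map fun q => (Fin.castLE hk q.1, q.2)) := by
      funext o
      rcases o with _ | ⟨i, j⟩
      · rfl
      · obtain rfl := Subsingleton.elim j 0
        by_cases hi : (i : ℕ) < k + 2
        · simp [padX, hi]
        · simpa [padX, hi] using hx' i (by omega)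
    have hpadY : y = padY K t (k + 2) fun i => y (Fin.castLE hk i) := by
      funext i
      by_cases hi : (i : ℕ) < k + 2
      · simp [padY, hi]
      · simpa [padY, hi] using hy' i (by omega)
    refine ⟨fun o => x (o.map fun q => (Fin.castLE hk q.1, q.2)), fun i => y (Fin.castLE hk i),
      fun h0 => hx0 (congrFun h0 (some (Fin.last (k + 1), 0))), fun h0 => hy ?_, ?_, hx0, ?_, ?_⟩
    · rw [hpadY, h0]
      funext i
      simp [padY]
    · intro j m n _
      obtain rfl := Subsingleton.elim j 0
      exact h.eq _ _
    · rw [← hpadX]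
      exact ScaleEq.refl x
    · rw [← hpadY]
      exact ScaleEq.refl y

end HirzebruchKleinschmidt

/-- Decomposition of a Hirzebruch–Kleinschmidt variety, case `r = 1`, `a₁ > 0`:
`X_t(a₁)(K)` is the disjoint union of (i) the image `ℙ^{t-1}₂` of `ℙ^{t-1}(K)` under `j₂`,
(ii) `ℙ¹₁ ∖ {P₀}`, and (iii) the images of the good open subsets `U_{t'}(a₁)(K)` under
`ι_{t'}` for `2 ≤ t' ≤ t`.  `K`-points of projective space are modeled by their nonzero
homogeneous coordinate vectors, up to the (scaling-invariant) equivalence `ScaleEq`;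
all the sets below are saturated under scaling, so this faithfully encodes the statement
at the level of `K`-points. -/
theorem stmt_11 (K : Type*) [Field K] (t : ℕ) (ht : 2 ≤ t) (a₁ : ℕ) (ha : 0 < a₁) :
    -- the set of `K`-points of `X_t(a₁)`, as pairs of coordinate vectors
    let bigX : Set ((Option (Fin t × Fin 1) → K) × (Fin t → K)) :=
      {p | p.1 ≠ 0 ∧ p.2 ≠ 0 ∧ HKrel K (fun _ : Fin 1 => a₁) p.1 p.2}
    -- (i) the image `ℙ^{t-1}₂` of `ℙ^{t-1}(K)` under `j₂`
    let P2 : Set ((Option (Fin t × Fin 1) → K) × (Fin t → K)) :=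
      {p | ∃ y : Fin t → K, y ≠ 0 ∧ ScaleEq K p.1 (e1X K t) ∧ ScaleEq K p.2 y}
    -- the image `ℙ¹₁` of `ℙ¹(K)` under `j₁`
    let P1 : Set ((Option (Fin t × Fin 1) → K) × (Fin t → K)) :=
      {p | ∃ z : Fin 2 → K, z ≠ 0 ∧ ScaleEq K p.1 (j1X K t z) ∧ ScaleEq K p.2 (e1Y K t)}
    -- the point `P₀ = ([1 : 0 : … : 0], [1 : 0 : … : 0])`
    let P0 : Set ((Option (Fin t × Fin 1) → K) × (Fin t → K)) :=
      {p | ScaleEq K p.1 (e1X K t) ∧ ScaleEq K p.2 (e1Y K t)}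
    -- (iii) the image of `U_{t'}(a₁)(K)` under `ι_{t'}`, for `t' = t'' + 2`
    let C : ℕ → Set ((Option (Fin t × Fin 1) → K) × (Fin t → K)) := fun t'' =>
      {p | ∃ (x : Option (Fin (t'' + 2) × Fin 1) → K) (y : Fin (t'' + 2) → K),
        x ≠ 0 ∧ y ≠ 0 ∧ HKrel K (fun _ : Fin 1 => a₁) x y ∧
        x (some (Fin.last (t'' + 1), 0)) ≠ 0 ∧
        ScaleEq K p.1 (padX K t (t'' + 2) x) ∧ ScaleEq K p.2 (padY K t (t'' + 2) y)}
    -- the decomposition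
    bigX = P2 ∪ (P1 \ P0) ∪ (⋃ (t'' : ℕ) (_ : t'' + 2 ≤ t), C t'') ∧
    -- pairwise disjointness of the pieces
    Disjoint P2 (P1 \ P0) ∧
    (∀ t'' : ℕ, t'' + 2 ≤ t → Disjoint P2 (C t'') ∧ Disjoint (P1 \ P0) (C t'')) ∧
    (∀ t₁ t₂ : ℕ, t₁ + 2 ≤ t → t₂ + 2 ≤ t → t₁ ≠ t₂ → Disjoint (C t₁) (C t₂)) := by
  intro bigX P2 P1 P0 C
  have hP2 : P2 = {p | p ∈ bigX ∧ ∀ i, p.1 (some (i, 0)) = 0} := setOf_scaleEq_e1X a₁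
  have hP1 : P1 \ P0 = {p | p ∈ bigX ∧ IsTopIndex p.1 0} :=
    setOf_scaleEq_j1X_diff (by omega) ha
  have hC : ∀ k, k + 2 ≤ t → C k = {p | p ∈ bigX ∧ IsTopIndex p.1 (k + 1)} :=
    fun k hk => setOf_scaleEq_pad hk ha
  rw [hP2, hP1]
  refine ⟨?_, ?_, fun k hk => ⟨?_, ?_⟩, fun k l hk hl hkl => ?_⟩
  · ext p
    simp only [Set.mem_union, Set.mem_iUnion, Set.mem_ofPred_eq]
    constructor
    · intro hp
      by_cases h0 : ∀ i, p.1 (some (i, 0)) = 0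
      · exact Or.inl (Or.inl ⟨hp, h0⟩)
      · push Not at h0
        obtain ⟨i, hi⟩ := h0
        obtain ⟨n, hn⟩ := exists_isTopIndex hi
        rcases n with _ | k
        · exact Or.inl (Or.inr ⟨hp, hn⟩)
        · have hk : k + 2 ≤ t := hn.1
          exact Or.inr ⟨k, hk, by rw [hC k hk]; exact ⟨hp, hn⟩⟩
    · rintro ((h | h) | ⟨k, hk, h⟩)
      · exact h.1
      · exact h.1
      · rw [hC k hk] at h
        exact h.1
  · exact Set.disjoint_left.2 fun p hp hq => hq.2.2.1 (hp.2 _)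
  · rw [hC k hk]
    exact Set.disjoint_left.2 fun p hp hq => hq.2.2.1 (hp.2 _)
  · rw [hC k hk]
    exact Set.disjoint_left.2 fun p hp hq => absurd (hp.2.unique hq.2) (by omega)
  · rw [hC k hk, hC l hl]
    exact Set.disjoint_left.2 fun p hp hq => absurd (hp.2.unique hq.2) (by omega)
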